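/- arXiv:1103.4566 — 2 statements merged into one kernel-verified Lean document; each statement's English description precedes it below -/
import Mathlib

section
/- Consider two stations in ℝ^d (d ≥ 1): s₁ at the origin and s₂ = a·e₁ with a > 0, with powers P₁, P₂ > 0, no background noise (N = 0), threshold β ≥ 1 and path-loss exponent 2α (α > 0), so that the reception zone of s₁ is H₁ = {p ∈ ℝ^d ∖ {s₁,s₂} : P₁·‖p−s₂‖^{2α} ≥ β·P₂·‖p−s₁‖^{2α}} ∪ {s₁}. Set τ = β·P₂/P₁, and when τ ≠ 1 set q = (a/(1−τ^{1/α}))·e₁ and R = a·τ^{1/(2α)}/|1−τ^{1/α}|. Then exactly one of the following holds: (C1) if τ > 1, then H₁ is the closed ball of radius R centered at q; (C2) if τ < 1, then H₁ = {p ∈ ℝ^d : ‖p−q‖ ≥ R}, the complement of the open ball of radius R centered at q; (C3) if τ = 1, then H₁ is the half-space {p ∈ ℝ^d : p₁ ≤ a/2}, where p₁ denotes the first coordinate of p. -/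
/-- Weighted power comparison of distances reduces to a comparison of the distances themselves. -/
lemma mul_rpow_two_mul_le_iff {A B α x y : ℝ} (hA : 0 < A) (hB : 0 < B) (hα : 0 < α)
    (hx : 0 ≤ x) (hy : 0 ≤ y) :
    A * x ^ (2 * α) ≤ B * y ^ (2 * α) ↔ (A / B) ^ (1 / (2 * α)) * x ≤ y := by
  have ht : 0 ≤ A / B := (div_pos hA hB).le
  rw [← Real.rpow_le_rpow_iff (z := 2 * α) (by positivity) hy (by positivity),
    Real.mul_rpow (by positivity) hx, ← Real.rpow_mul ht,
    one_div_mul_cancel (by positivity), Real.rpow_one, div_mul_eq_mul_div, div_le_iff₀ hB,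
    mul_comm B]

lemma EuclideanSpace.dist_sq_smul_single {ι : Type*} [Fintype ι] [DecidableEq ι]
    (p : EuclideanSpace ℝ ι) (i : ι) (b : ℝ) :
    dist p (b • EuclideanSpace.single i (1 : ℝ)) ^ 2 = dist p 0 ^ 2 - 2 * b * p i + b ^ 2 := by
  rw [dist_eq_norm, dist_zero_right, norm_sub_sq_real, real_inner_smul_right, norm_smul,
    EuclideanSpace.inner_single_right]
  simp
  ring

theorem two_station_reception_zone_classification {d : ℕ} (hd : 0 < d)
    (a : ℝ) (ha : 0 < a)
    (P₁ P₂ β α : ℝ) (hP₁ : 0 < P₁) (hP₂ : 0 < P₂) (hβ : 1 ≤ β) (hα : 0 < α) :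
    let e₁ : EuclideanSpace ℝ (Fin d) := EuclideanSpace.single ⟨0, hd⟩ 1
    let s₂ : EuclideanSpace ℝ (Fin d) := a • e₁
    -- the reception zone of the station `s₁ = 0`
    let H₁ : Set (EuclideanSpace ℝ (Fin d)) :=
      {p | p ≠ 0 ∧ p ≠ s₂ ∧ β * P₂ * dist p 0 ^ (2 * α) ≤ P₁ * dist p s₂ ^ (2 * α)} ∪ {0}
    let τ : ℝ := β * P₂ / P₁
    let q : EuclideanSpace ℝ (Fin d) := (a / (1 - τ ^ (1 / α))) • e₁
    let R : ℝ := a * τ ^ (1 / (2 * α)) / |1 - τ ^ (1 / α)|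
    (1 < τ → H₁ = Metric.closedBall q R) ∧
    (τ < 1 → H₁ = {p | R ≤ dist p q}) ∧
    (τ = 1 → H₁ = {p | p ⟨0, hd⟩ ≤ a / 2}) := by
  intro e₁ s₂ H₁ τ q R
  have hβP : 0 < β * P₂ := by positivity
  have hτ : 0 < τ := div_pos hβP hP₁
  set t : ℝ := τ ^ (1 / (2 * α)) with ht
  have ht0 : 0 < t := Real.rpow_pos_of_pos hτ _
  have hc : τ ^ (1 / α) = t ^ 2 := by
    rw [ht, ← Real.rpow_natCast, ← Real.rpow_mul hτ.le]
    congr 1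
    push_cast
    field_simp
  have hR : R = a * t / |1 - t ^ 2| := by simp only [R, hc, ht]
  have hR0 : 0 ≤ R := by rw [hR]; positivity
  have hs₂ (p) : dist p s₂ ^ 2 = dist p 0 ^ 2 - 2 * a * p ⟨0, hd⟩ + a ^ 2 :=
    EuclideanSpace.dist_sq_smul_single p _ a
  have hq (p) : dist p q ^ 2 =
      dist p 0 ^ 2 - 2 * (a / (1 - t ^ 2)) * p ⟨0, hd⟩ + (a / (1 - t ^ 2)) ^ 2 := by
    rw [← hc]
    exact EuclideanSpace.dist_sq_smul_single p _ _
  have hmem (p) : p ∈ H₁ ↔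
      t ^ 2 * dist p 0 ^ 2 ≤ dist p 0 ^ 2 - 2 * a * p ⟨0, hd⟩ + a ^ 2 := by
    rw [← hs₂, ← mul_pow, pow_le_pow_iff_left₀ (by positivity) dist_nonneg two_ne_zero]
    simp only [H₁, Set.mem_union, Set.mem_ofPred_eq, Set.mem_singleton_iff,
      mul_rpow_two_mul_le_iff hβP hP₁ hα dist_nonneg dist_nonneg]
    change (p ≠ 0 ∧ p ≠ s₂ ∧ t * dist p 0 ≤ dist p s₂) ∨ p = 0 ↔ _
    by_cases h0 : p = 0
    · simp [h0]
    · have : t * dist p 0 ≤ dist p s₂ → p ≠ s₂ := by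
        rintro h rfl
        rw [dist_self] at h
        exact absurd h (not_le.2 (mul_pos ht0 (dist_pos.2 h0)))
      tauto
  have hdiff (h : 1 - t ^ 2 ≠ 0) (p) : (1 - t ^ 2) * (dist p q ^ 2 - R ^ 2) =
      dist p 0 ^ 2 - 2 * a * p ⟨0, hd⟩ + a ^ 2 - t ^ 2 * dist p 0 ^ 2 := by
    rw [hq, hR, div_pow _ |_|, sq_abs]
    field_simp
    ring
  refine ⟨fun h ↦ ?_, fun h ↦ ?_, fun h ↦ ?_⟩
  · have h1 : 1 - t ^ 2 < 0 := by
      rw [← hc, sub_neg]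
      exact Real.one_lt_rpow h (by positivity)
    ext p
    rw [hmem, Metric.mem_closedBall, ← pow_le_pow_iff_left₀ dist_nonneg hR0 two_ne_zero,
      ← sub_nonneg, ← hdiff h1.ne p, ← neg_mul_neg,
      mul_nonneg_iff_of_pos_left (neg_pos.2 h1), neg_sub, sub_nonneg]
  · have h1 : 0 < 1 - t ^ 2 := by
      rw [← hc, sub_pos]
      exact Real.rpow_lt_one hτ.le h (by positivity)
    ext p
    rw [hmem, Set.mem_ofPred_eq, ← pow_le_pow_iff_left₀ hR0 dist_nonneg two_ne_zero,
      ← sub_nonneg, ← hdiff h1.ne' p, mul_nonneg_iff_of_pos_left h1, sub_nonneg]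
  · have h1 : t = 1 := by rw [ht, h, Real.one_rpow]
    ext p
    rw [hmem, Set.mem_ofPred_eq, h1]
    constructor <;> intro hp <;> nlinarith
end

section
/- For every dimension d ≥ 1 there exists a constant c = c(d) > 0 such that for every wireless network in ℝ^d with n ≥ 2 stations, powers P_i > 0, noise N ≥ 0, threshold β ≥ 1 and path-loss exponent 2, each reception zone H_i has finitely many connected components, and the total number of connected components summed over H₁,…,H_n is at most c·n^{d+1}. -/
open Finset

/-- SINR of station `i` at point `p`, for stations `s` in `ℝ^d`, powers `P`,
noise `N` and path-loss exponent 2. -/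
noncomputable def sinr2 {d n : ℕ} (s : Fin n → EuclideanSpace ℝ (Fin d))
    (P : Fin n → ℝ) (N : ℝ) (i : Fin n) (p : EuclideanSpace ℝ (Fin d)) : ℝ :=
  (P i / dist p (s i) ^ 2) /
    ((∑ j ∈ Finset.univ.erase i, P j / dist p (s j) ^ 2) + N)

/-- The reception zone of station `i`. -/
noncomputable def recZone2 {d n : ℕ} (s : Fin n → EuclideanSpace ℝ (Fin d))
    (P : Fin n → ℝ) (N β : ℝ) (i : Fin n) : Set (EuclideanSpace ℝ (Fin d)) :=
  {p | p ∉ Set.range s ∧ β ≤ sinr2 s P N i p} ∪ {s i}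

/-- The set of connected components (cells) of a set `S`. -/
def componentsOf {X : Type*} [TopologicalSpace X] (S : Set X) : Set (Set X) :=
  {C | ∃ t ∈ S, C = connectedComponentIn S t}

namespace MvPolynomial

/-- A polynomial system whose `i`-th equation has leading term `a * X i ^ D` has at most
`D ^ #σ` solutions. -/
theorem card_le_pow_of_eval_eq_zero {ι σ : Type*} [Fintype ι] [Fintype σ] {D : ℕ} {a : ℝ}
    (ha : a ≠ 0) (r : σ → MvPolynomial σ ℝ) (hr : ∀ i, (r i).totalDegree < D)
    (x : ι → σ → ℝ) (hx : Function.Injective x)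
    (h : ∀ k i, a * x k i ^ D + eval (x k) (r i) = 0) :
    Fintype.card ι ≤ D ^ Fintype.card σ := by
  classical
  let ev : MvPolynomial σ ℝ →ₗ[ℝ] (ι → ℝ) := LinearMap.pi fun k => (aeval (x k)).toLinearMap
  have ev_apply : ∀ p k, ev p k = eval (x k) p := fun p k => by simp [ev, aeval_eq_eval]
  let mon : (σ → Fin D) → ι → ℝ := fun e k => ∏ i, x k i ^ (e i : ℕ)
  have reduce : ∀ N : ℕ, ∀ p : MvPolynomial σ ℝ, p.totalDegree ≤ N →
      ev p ∈ Submodule.span ℝ (Set.range mon) := by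
    intro N
    induction N using Nat.strong_induction_on with
    | _ N ih =>
      intro p hp
      rw [p.as_sum, map_sum]
      refine Submodule.sum_mem _ fun m hm => ?_
      have hdeg : m.degree ≤ N := (le_totalDegree hm).trans hp
      by_cases hlt : ∀ i, m i < D
      · have : ev (monomial m (coeff m p)) = coeff m p • mon fun i => ⟨m i, hlt i⟩ := by
          ext k
          simp [ev_apply, mon, eval_monomial, Finsupp.prod_fintype]
        rw [this]
        exact Submodule.smul_mem _ _ (Submodule.subset_span ⟨_, rfl⟩)
      · push Not at hlt
        obtain ⟨i, hi⟩ := hlt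
        have hle : Finsupp.single i D ≤ m := by simpa using hi
        obtain ⟨m', rfl⟩ := exists_add_of_le hle
        have hred : ev (monomial (Finsupp.single i D + m') (coeff (Finsupp.single i D + m') p)) =
            ev (monomial m' (-coeff (Finsupp.single i D + m') p / a) * r i) := by
          ext k
          have hk : x k i ^ D = -eval (x k) (r i) / a := by
            rw [eq_div_iff ha]
            linarith [h k i]
          have hs : ((Finsupp.single i D + m').prod fun n e => x k n ^ e) =
              x k i ^ D * m'.prod fun n e => x k n ^ e := by
            rw [Finsupp.prod_add_index' (by simp) (by simp [pow_add])]
            simp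
          rw [ev_apply, ev_apply, eval_monomial, map_mul, eval_monomial, hs, hk]
          field_simp
        rw [hred]
        have hD : D + m'.degree ≤ N := by simpa using hdeg
        have hlt' : m'.degree + (r i).totalDegree < N := by have := hr i; omega
        exact ih _ hlt' _ ((totalDegree_mul _ _).trans
          (Nat.add_le_add_right (totalDegree_monomial_le _ _) _))
  have hspan : Submodule.span ℝ (Set.range mon) = ⊤ := by
    rw [eq_top_iff, ← (Pi.basisFun ℝ ι).span_eq, Submodule.span_le]
    rintro _ ⟨k, rfl⟩
    let q : MvPolynomial σ ℝ := ∏ l ∈ Finset.univ.erase k, ∑ i, (X i - C (x l i)) ^ 2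
    have hq : ∀ l, eval (x l) q = ∏ j ∈ Finset.univ.erase k, ∑ i, (x l i - x j i) ^ 2 := by
      intro l
      simp [q, map_prod, map_sum]
    have hk : eval (x k) q ≠ 0 := by
      rw [hq, Finset.prod_ne_zero_iff]
      intro l hl h0
      refine (Finset.ne_of_mem_erase hl) (hx ?_)
      rw [Finset.sum_eq_zero_iff_of_nonneg fun _ _ => sq_nonneg _] at h0
      ext i
      have := h0 i (Finset.mem_univ i)
      linarith [pow_eq_zero_iff (two_ne_zero) |>.1 this]
    have hsingle : (Pi.basisFun ℝ ι) k = (eval (x k) q)⁻¹ • ev q := by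
      ext l
      rw [Pi.smul_apply, ev_apply, Pi.basisFun_apply, smul_eq_mul]
      by_cases hlk : l = k
      · subst hlk
        simp [hk]
      · rw [Pi.single_eq_of_ne hlk, hq l,
          Finset.prod_eq_zero (Finset.mem_erase.2 ⟨hlk, Finset.mem_univ l⟩) (by simp), mul_zero]
    rw [hsingle]
    exact Submodule.smul_mem _ _ (reduce _ q le_rfl)
  calc Fintype.card ι = Module.finrank ℝ (ι → ℝ) := by simp
    _ = (Set.range mon).finrank ℝ := by rw [Set.finrank, hspan, finrank_top]
    _ ≤ Fintype.card (σ → Fin D) := finrank_range_le_card mon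
    _ = D ^ Fintype.card σ := by simp

theorem totalDegree_pderiv_lt {R σ : Type*} [CommSemiring R] {p : MvPolynomial σ R} {D : ℕ}
    (hD : 0 < D) (hp : p.totalDegree ≤ D) (i : σ) : (pderiv i p).totalDegree < D := by
  rw [totalDegree, Finset.sup_lt_iff (by simpa using hD)]
  intro m hm
  rw [mem_support_iff, coeff_pderiv] at hm
  have hm' : m + Finsupp.single i 1 ∈ p.support := mem_support_iff.2 (left_ne_zero_of_mul hm)
  have : (m + Finsupp.single i 1).degree ≤ D := (le_totalDegree hm').trans hp
  have h' : m.degree + 1 ≤ D := by simpa using this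
  exact h'

theorem hasDerivAt_eval_update {σ : Type*} [DecidableEq σ] (p : MvPolynomial σ ℝ) (x : σ → ℝ)
    (i : σ) (t : ℝ) :
    HasDerivAt (fun u => eval (Function.update x i u) p)
      (eval (Function.update x i t) (pderiv i p)) t := by
  induction p using MvPolynomial.induction_on with
  | C a => simpa using hasDerivAt_const t a
  | add p q hp hq => simpa using HasDerivAt.fun_add hp hq
  | mul_X p j hp =>
    have hX : HasDerivAt (fun u => Function.update x i u j)
        (eval (Function.update x i t) (pderiv i (X j : MvPolynomial σ ℝ))) t := by
      by_cases hj : j = i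
      · subst hj
        simpa using hasDerivAt_id' t
      · simpa [Function.update_of_ne hj, pderiv_X_of_ne hj] using hasDerivAt_const t (x j)
    have hval : eval (Function.update x i t) (pderiv i (p * X j)) =
        eval (Function.update x i t) (pderiv i p) * Function.update x i t j +
          eval (Function.update x i t) p * eval (Function.update x i t) (pderiv i (X j)) := by
      rw [pderiv_mul, map_add, map_mul, map_mul, eval_X]
    rw [hval]
    simpa only [map_mul, eval_X] using HasDerivAt.fun_mul hp hX

theorem continuous_eval_ofLp {σ : Type*} [Fintype σ] (p : MvPolynomial σ ℝ) :
    Continuous fun x : EuclideanSpace ℝ σ => eval x.ofLp p :=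
  (continuous_eval p).comp (PiLp.continuous_ofLp 2 _)

theorem eval_pderiv_eq_zero_of_isLocalMin {σ : Type*} [Fintype σ] {p : MvPolynomial σ ℝ}
    {x : EuclideanSpace ℝ σ}
    (h : IsLocalMin (fun y : EuclideanSpace ℝ σ => eval y.ofLp p) x) (i : σ) :
    eval x.ofLp (pderiv i p) = 0 := by
  classical
  let γ : ℝ → EuclideanSpace ℝ σ := fun u => WithLp.toLp 2 (Function.update x.ofLp i u)
  have hγ : Continuous γ :=
    (PiLp.continuous_toLp 2 _).comp (continuous_const.update i continuous_id)
  have hγx : γ (x.ofLp i) = x := by simp [γ]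
  have hmin : IsLocalMin ((fun y : EuclideanSpace ℝ σ => eval y.ofLp p) ∘ γ) (x.ofLp i) := by
    refine IsLocalMin.comp_continuous ?_ hγ.continuousAt
    rwa [hγx]
  simpa using hmin.hasDerivAt_eq_zero (hasDerivAt_eval_update p x.ofLp i (x.ofLp i))

/-- A polynomial of degree at most `2 m + 1` that is negative somewhere on each of finitely many
disjoint bounded open sets, and nonnegative on their boundaries: there are at most
`(2 m + 1) ^ #σ` such sets. -/
theorem card_le_pow_of_neg_of_frontier_nonneg {ι σ : Type*} [Fintype ι] [Fintype σ] {m : ℕ}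
    (p : MvPolynomial σ ℝ) (hp : p.totalDegree ≤ 2 * m + 1) (U : ι → Set (EuclideanSpace ℝ σ))
    (hUo : ∀ k, IsOpen (U k)) (hUb : ∀ k, Bornology.IsBounded (U k))
    (hUd : Pairwise fun k l => Disjoint (U k) (U l)) (y : ι → EuclideanSpace ℝ σ)
    (hyU : ∀ k, y k ∈ U k) (hy : ∀ k, eval (y k).ofLp p < 0)
    (hb : ∀ k, ∀ x ∈ closure (U k), x ∉ U k → 0 ≤ eval x.ofLp p) :
    Fintype.card ι ≤ (2 * m + 1) ^ Fintype.card σ := by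
  classical
  let ψ : MvPolynomial σ ℝ := ∑ i, X i ^ (2 * m + 2)
  have hψ : ∀ x : σ → ℝ, eval x ψ = ∑ i, x i ^ (2 * m + 2) := fun x => by simp [ψ]
  have hψ0 : ∀ x : σ → ℝ, 0 ≤ eval x ψ := fun x => by
    rw [hψ]
    exact Finset.sum_nonneg fun i _ => (show Even (2 * m + 2) from ⟨m + 1, by ring⟩).pow_nonneg _
  have hev : ∀ᶠ ε : ℝ in nhdsWithin 0 (Set.Ioi 0),
      ∀ k, eval (y k).ofLp p + ε * eval (y k).ofLp ψ < 0 := by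
    rw [Filter.eventually_all]
    intro k
    have hc : Continuous fun ε : ℝ => eval (y k).ofLp p + ε * eval (y k).ofLp ψ := by fun_prop
    exact nhdsWithin_le_nhds (hc.continuousAt.eventually_lt_const (by simpa using hy k))
  obtain ⟨ε, hε, hε0⟩ := (hev.and self_mem_nhdsWithin).exists
  replace hε0 : 0 < ε := hε0
  let G : MvPolynomial σ ℝ := p + C ε * ψ
  have hG : ∀ x : σ → ℝ, eval x G = eval x p + ε * eval x ψ := fun x => by simp [G]
  have hmin : ∀ k, ∃ x ∈ U k, ∀ i, eval x.ofLp (pderiv i G) = 0 := by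
    intro k
    obtain ⟨x, hx, hxmin⟩ := (hUb k).isCompact_closure.exists_isMinOn
      ⟨y k, subset_closure (hyU k)⟩ (continuous_eval_ofLp G).continuousOn
    have hxU : x ∈ U k := by
      by_contra hxU
      have h1 : eval x.ofLp G ≤ eval (y k).ofLp G := hxmin (subset_closure (hyU k))
      have h2 := hε k
      have h3 := hb k x hx hxU
      have h4 := mul_nonneg hε0.le (hψ0 x.ofLp)
      rw [hG, hG] at h1
      linarith
    exact ⟨x, hxU, eval_pderiv_eq_zero_of_isLocalMin
      (hxmin.isLocalMin (Filter.mem_of_superset ((hUo k).mem_nhds hxU) subset_closure))⟩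
  choose x hxU hx using hmin
  refine card_le_pow_of_eval_eq_zero (a := ε * (2 * m + 2)) (by positivity) (fun i => pderiv i p)
    (totalDegree_pderiv_lt (by omega) hp) (fun k => (x k).ofLp) ?_ fun k i => ?_
  · intro k l hkl
    by_contra hne
    have hxl : x k = x l := WithLp.ofLp_injective 2 hkl
    exact Set.disjoint_left.1 (hUd hne) (hxU k) (hxl ▸ hxU l)
  · have := hx k i
    have hd : pderiv i ψ = C (2 * (m : ℝ) + 2) * X i ^ (2 * m + 1) := by
      simp only [ψ, map_sum, pderiv_pow, pderiv_X]
      rw [Finset.sum_eq_single i (fun j _ hj => by simp [Pi.single_eq_of_ne hj]) (by simp)]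
      simp [show (C 2 : MvPolynomial σ ℝ) = 2 from rfl]
    simp only [G, map_add, pderiv_C_mul, hd, map_mul, eval_C, map_pow, eval_X] at this
    linarith

end MvPolynomial

/-- Finitely many points in distinct components of a set `S` have disjoint open neighbourhoods
whose boundaries miss a given compact subset `K` of `S` containing the points. -/
theorem exists_isOpen_disjoint_frontier_of_connectedComponentIn_ne {X ι : Type*}
    [TopologicalSpace X] [T2Space X] [NormalSpace X] [Finite ι] {S K : Set X} (hK : IsCompact K)
    (hKS : K ⊆ S) (y : ι → X) (hyK : ∀ k, y k ∈ K)
    (hy : Pairwise fun k l => connectedComponentIn S (y k) ≠ connectedComponentIn S (y l)) :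
    ∃ V : ι → Set X, (∀ k, IsOpen (V k)) ∧ (Pairwise fun k l => Disjoint (V k) (V l)) ∧
      (∀ k, y k ∈ V k) ∧ ∀ k, Disjoint (frontier (V k)) K := by
  classical
  have : CompactSpace K := isCompact_iff_compactSpace.1 hK
  have hsep : ∀ k l, ∃ f : C(X, ℝ), (∀ z ∈ K, f z = 0 ∨ f z = 1) ∧
      (k ≠ l → f (y k) = 1 ∧ f (y l) = 0) := by
    intro k l
    by_cases hkl : k = l
    · exact ⟨0, fun _ _ => Or.inl rfl, fun h => absurd hkl h⟩
    have hnot : (⟨y l, hyK l⟩ : K) ∉ connectedComponent (⟨y k, hyK k⟩ : K) := by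
      intro hmem
      refine hy hkl (connectedComponentIn_eq ?_)
      have hpre := isPreconnected_connectedComponent (x := (⟨y k, hyK k⟩ : K)).image
        Subtype.val continuous_subtype_val.continuousOn
      refine hpre.subset_connectedComponentIn ⟨_, mem_connectedComponent, rfl⟩ ?_ ⟨_, hmem, rfl⟩
      rintro _ ⟨z, -, rfl⟩
      exact hKS z.2
    rw [connectedComponent_eq_iInter_isClopen, Set.mem_iInter] at hnot
    push Not at hnot
    obtain ⟨⟨Z, hZ, hkZ⟩, hlZ⟩ := hnot
    let g : C(K, ℝ) := ⟨Z.indicator 1, continuous_one.indicator fun a ha => by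
      simp [hZ.frontier_eq] at ha⟩
    obtain ⟨f, hf⟩ := ContinuousMap.exists_restrict_eq hK.isClosed g
    have hfz : ∀ z : K, f z = Z.indicator 1 z := fun z => DFunLike.congr_fun hf z
    refine ⟨f, fun z hz => ?_, fun _ => ⟨?_, ?_⟩⟩
    · rw [hfz ⟨z, hz⟩]
      exact Set.indicator_eq_zero_or_self _ _ _
    · rw [hfz ⟨y k, hyK k⟩, Set.indicator_of_mem hkZ, Pi.one_apply]
    · rw [hfz ⟨y l, hyK l⟩, Set.indicator_of_notMem hlZ]
  choose f hf01 hf using hsep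
  let V : ι → Set X := fun k => {x | ∀ l, k ≠ l → 1 / 2 < f k l x ∧ f l k x < 1 / 2}
  have hVo : ∀ k, IsOpen (V k) := fun k => by
    simp only [V, Set.ofPred_forall]
    refine isOpen_iInter_of_finite fun l => isOpen_iInter_of_finite fun _ => ?_
    exact (isOpen_lt continuous_const (f k l).continuous).inter
      (isOpen_lt (f l k).continuous continuous_const)
  refine ⟨V, hVo, fun k l hkl => ?_, fun k l hkl => ?_, fun k => ?_⟩
  · refine Set.disjoint_left.2 fun x hk hl => ?_
    linarith [(hk l hkl).1, (hl k hkl.symm).2]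
  · rw [(hf k l hkl).1, (hf l k hkl.symm).2]
    norm_num
  · rw [Set.disjoint_left]
    intro x hx hxK
    rw [(hVo k).frontier_eq] at hx
    refine hx.2 fun l hkl => ?_
    have hcl : closure (V k) ⊆ {x | 1 / 2 ≤ f k l x ∧ f l k x ≤ 1 / 2} := by
      refine closure_minimal (fun z hz => ⟨(hz l hkl).1.le, (hz l hkl).2.le⟩) ?_
      exact (isClosed_le continuous_const (f k l).continuous).inter
        (isClosed_le (f l k).continuous continuous_const)
    obtain ⟨h1, h2⟩ := hcl hx.1
    constructor
    · rcases hf01 k l x hxK with h | h <;> linarith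
    · rcases hf01 l k x hxK with h | h <;> linarith

/-- Points in distinct components of `{g ≤ 0}`, for `g` a polynomial of degree at most `2 m - 1`,
number at most `(2 m + 1) ^ #σ`. -/
theorem card_le_pow_of_connectedComponentIn_ne {ι σ : Type*} [Fintype ι] [Fintype σ] {m : ℕ}
    (g : MvPolynomial σ ℝ) (hg : g.totalDegree + 2 ≤ 2 * m + 1) (y : ι → EuclideanSpace ℝ σ)
    (hyS : ∀ k, MvPolynomial.eval (y k).ofLp g ≤ 0)
    (hy : Pairwise fun k l =>
      connectedComponentIn {x : EuclideanSpace ℝ σ | MvPolynomial.eval x.ofLp g ≤ 0} (y k) ≠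
      connectedComponentIn {x : EuclideanSpace ℝ σ | MvPolynomial.eval x.ofLp g ≤ 0} (y l)) :
    Fintype.card ι ≤ (2 * m + 1) ^ Fintype.card σ := by
  classical
  let u : EuclideanSpace ℝ σ → ℝ := fun x => MvPolynomial.eval x.ofLp g
  let v : EuclideanSpace ℝ σ → ℝ := fun x => ∑ i, x i ^ 2
  have hu : Continuous u := MvPolynomial.continuous_eval_ofLp g
  have hvn : ∀ x, v x = ‖x‖ ^ 2 := fun x => (EuclideanSpace.real_norm_sq_eq x).symm
  have hv : Continuous v := by
    simp only [funext hvn]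
    fun_prop
  obtain ⟨R, hR⟩ : ∃ R, ∀ k, v (y k) ≤ R := by
    obtain ⟨R, hR⟩ := (Set.finite_range fun k => v (y k)).bddAbove
    exact ⟨R, fun k => hR ⟨k, rfl⟩⟩
  have hbdd : ∀ r, Bornology.IsBounded {x | v x ≤ r} := by
    intro r
    refine (Metric.isBounded_closedBall (x := 0) (r := √r)).subset fun x hx => ?_
    rw [mem_closedBall_zero_iff]
    exact Real.le_sqrt_of_sq_le ((hvn x).symm.trans_le hx)
  have hcpt : ∀ r, IsCompact {x | v x ≤ r} := fun r =>
    Metric.isCompact_of_isClosed_isBounded (isClosed_le hv continuous_const) (hbdd r)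
  have hK : IsCompact {x | u x ≤ 0 ∧ v x ≤ R} :=
    (hcpt R).inter_left (isClosed_le hu continuous_const)
  obtain ⟨V, hVo, hVd, hyV, hVK⟩ := exists_isOpen_disjoint_frontier_of_connectedComponentIn_ne hK
    (fun x hx => hx.1) y (fun k => ⟨hyS k, hR k⟩) hy
  let A : Set (EuclideanSpace ℝ σ) := (⋃ k, frontier (V k)) ∩ {x | v x ≤ R + 1}
  have hA : IsCompact A :=
    (hcpt (R + 1)).inter_left (isClosed_iUnion_of_finite fun k => isClosed_frontier)
  obtain ⟨δ, hδ, hδA⟩ : ∃ δ, 0 < δ ∧ ∀ x ∈ A, δ ≤ max (u x) (v x - R) := by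
    refine hA.exists_forall_le' (hu.max (hv.sub continuous_const)).continuousOn fun x hx => ?_
    obtain ⟨k, hk⟩ := Set.mem_iUnion.1 hx.1
    by_contra! hle
    rw [max_le_iff] at hle
    exact Set.disjoint_left.1 (hVK k) hk ⟨hle.1, sub_nonpos.1 hle.2⟩
  let η := min δ 1 / 2
  have hη0 : 0 < η := by positivity
  have hη1 : η < 1 := by have := min_le_right δ 1; simp only [η]; linarith
  have hηδ : η < δ := by have := min_le_left δ 1; simp only [η]; linarith
  let W : Set (EuclideanSpace ℝ σ) := {x | u x < η ∧ v x < R + η}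
  have hWo : IsOpen W :=
    (isOpen_lt hu continuous_const).inter (isOpen_lt hv continuous_const)
  let p : MvPolynomial σ ℝ :=
    (g - MvPolynomial.C η) * (MvPolynomial.C (R + η) - ∑ i, MvPolynomial.X i ^ 2)
  have hp : ∀ x : EuclideanSpace ℝ σ, MvPolynomial.eval x.ofLp p = (u x - η) * (R + η - v x) :=
    fun x => by simp [p, u, v]
  have hdeg : p.totalDegree ≤ 2 * m + 1 := by
    refine (MvPolynomial.totalDegree_mul _ _).trans (le_trans ?_ hg)
    gcongr
    · exact MvPolynomial.totalDegree_sub_C_le _ _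
    · refine (MvPolynomial.totalDegree_sub _ _).trans (max_le ?_ ?_)
      · rw [MvPolynomial.totalDegree_C]
        exact Nat.zero_le 2
      exact MvPolynomial.totalDegree_finsetSum_le fun i _ => by
        rw [MvPolynomial.totalDegree_X_pow]
  refine MvPolynomial.card_le_pow_of_neg_of_frontier_nonneg p hdeg (fun k => V k ∩ W)
    (fun k => (hVo k).inter hWo) (fun k => (hbdd (R + η)).subset fun x hx => hx.2.2.le)
    (fun k l hkl => (hVd hkl).mono Set.inter_subset_left Set.inter_subset_left) y ?_ ?_ ?_
  · exact fun k => ⟨hyV k, (hyS k).trans_lt hη0, by linarith [hR k]⟩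
  · intro k
    rw [hp]
    exact mul_neg_of_neg_of_pos (by linarith [show u (y k) ≤ 0 from hyS k]) (by linarith [hR k])
  · intro k x hx hxn
    have hxW : u x ≤ η ∧ v x ≤ R + η := by
      have : closure W ⊆ {x | u x ≤ η ∧ v x ≤ R + η} :=
        closure_minimal (fun z hz => ⟨hz.1.le, hz.2.le⟩)
          ((isClosed_le hu continuous_const).inter (isClosed_le hv continuous_const))
      exact this (closure_mono Set.inter_subset_right hx)
    have hxV : x ∈ V k := by
      by_contra hxV
      have hxA : x ∈ A := by
        refine ⟨Set.mem_iUnion.2 ⟨k, ?_⟩, ?_⟩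
        · rw [(hVo k).frontier_eq]
          exact ⟨closure_mono Set.inter_subset_left hx, hxV⟩
        · show v x ≤ R + 1
          linarith [hxW.2]
      have := hδA x hxA
      have h2 : max (u x) (v x - R) ≤ η := max_le hxW.1 (by linarith [hxW.2])
      linarith
    rw [hp]
    by_cases h1 : u x < η
    · have h2 : v x = R + η := by
        refine hxW.2.antisymm (not_lt.1 fun h2 => hxn ⟨hxV, h1, h2⟩)
      simp [h2]
    · simp [hxW.1.antisymm (not_lt.1 h1)]

theorem finite_componentsOf_and_ncard_le {X : Type*} [TopologicalSpace X] {S : Set X} {B : ℕ}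
    (h : ∀ (ι : Type) [Fintype ι] (y : ι → X), (∀ k, y k ∈ S) →
      (Pairwise fun k l => connectedComponentIn S (y k) ≠ connectedComponentIn S (y l)) →
      Fintype.card ι ≤ B) :
    (componentsOf S).Finite ∧ (componentsOf S).ncard ≤ B := by
  have key : (componentsOf S).encard ≤ B := by
    by_contra! hlt
    have hle : ((B + 1 : ℕ) : ℕ∞) ≤ (componentsOf S).encard := by
      simpa using Order.add_one_le_of_lt hlt
    obtain ⟨t, htS, ht⟩ := Set.exists_subset_encard_eq hle
    have htf : t.Finite := Set.finite_of_encard_eq_coe ht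
    have := htf.fintype
    choose y hyS hy using fun C : t => htS C.2
    let e := Fintype.equivFin t
    have hcard := h (Fin (Fintype.card t)) (fun k => y (e.symm k)) (fun k => hyS _)
      fun k l hkl heq => hkl <| e.symm.injective <| Subtype.ext <| by
        rw [hy (e.symm k), hy (e.symm l)]
        exact heq
    rw [Fintype.card_fin, ← Set.toFinset_card, ← Set.ncard_eq_toFinset_card',
      Set.ncard, ht, ENat.toNat_natCast] at hcard
    omega
  have hfin : (componentsOf S).Finite := Set.finite_of_encard_le_coe key
  refine ⟨hfin, ?_⟩
  rw [← hfin.cast_ncard_eq] at key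
  exact_mod_cast key

/-- The polynomial `∑ᵢ (Xᵢ - aᵢ)²`, the squared distance to the point `a`. -/
noncomputable def sqDistPoly {d : ℕ} (a : EuclideanSpace ℝ (Fin d)) : MvPolynomial (Fin d) ℝ :=
  ∑ i, (MvPolynomial.X i - MvPolynomial.C (a i)) ^ 2

theorem eval_sqDistPoly {d : ℕ} (a x : EuclideanSpace ℝ (Fin d)) :
    MvPolynomial.eval x.ofLp (sqDistPoly a) = dist x a ^ 2 := by
  rw [EuclideanSpace.dist_sq_eq]
  simp [sqDistPoly, Real.dist_eq, sq_abs]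

theorem totalDegree_sqDistPoly_le {d : ℕ} (a : EuclideanSpace ℝ (Fin d)) :
    (sqDistPoly a).totalDegree ≤ 2 := by
  refine MvPolynomial.totalDegree_finsetSum_le fun i _ => ?_
  refine (MvPolynomial.totalDegree_pow _ _).trans ?_
  have := MvPolynomial.totalDegree_sub_C_le (MvPolynomial.X i : MvPolynomial (Fin d) ℝ) (a i)
  rw [MvPolynomial.totalDegree_X] at this
  omega

theorem totalDegree_prod_sqDistPoly_le {d n : ℕ} (s : Fin n → EuclideanSpace ℝ (Fin d))
    (t : Finset (Fin n)) : (∏ j ∈ t, sqDistPoly (s j)).totalDegree ≤ 2 * n := by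
  refine (MvPolynomial.totalDegree_finsetProd _ _).trans ?_
  refine (Finset.sum_le_card_nsmul _ _ 2 fun j _ => totalDegree_sqDistPoly_le (s j)).trans ?_
  have := Finset.card_le_univ t
  simp only [Fintype.card_fin, smul_eq_mul] at this ⊢
  omega

/-- The polynomial whose nonpositivity set is the reception zone of station `i`, obtained by
clearing the denominators of the SINR condition. -/
noncomputable def recPoly {d n : ℕ} (s : Fin n → EuclideanSpace ℝ (Fin d))
    (P : Fin n → ℝ) (N β : ℝ) (i : Fin n) : MvPolynomial (Fin d) ℝ :=
  MvPolynomial.C β * ((∑ j ∈ Finset.univ.erase i,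
      MvPolynomial.C (P j) * ∏ l ∈ Finset.univ.erase j, sqDistPoly (s l)) +
    MvPolynomial.C N * ∏ l, sqDistPoly (s l)) -
  MvPolynomial.C (P i) * ∏ l ∈ Finset.univ.erase i, sqDistPoly (s l)

theorem totalDegree_recPoly_le {d n : ℕ} (s : Fin n → EuclideanSpace ℝ (Fin d))
    (P : Fin n → ℝ) (N β : ℝ) (i : Fin n) : (recPoly s P N β i).totalDegree ≤ 2 * n := by
  have hC : ∀ (a : ℝ) (p : MvPolynomial (Fin d) ℝ), p.totalDegree ≤ 2 * n →
      (MvPolynomial.C a * p).totalDegree ≤ 2 * n := fun a p hp => by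
    rw [MvPolynomial.C_mul']
    exact (MvPolynomial.totalDegree_smul_le _ _).trans hp
  refine (MvPolynomial.totalDegree_sub _ _).trans (max_le (hC _ _ ?_)
    (hC _ _ (totalDegree_prod_sqDistPoly_le s _)))
  refine (MvPolynomial.totalDegree_add _ _).trans (max_le ?_
    (hC _ _ (totalDegree_prod_sqDistPoly_le s _)))
  exact MvPolynomial.totalDegree_finsetSum_le fun j _ =>
    hC _ _ (totalDegree_prod_sqDistPoly_le s _)

theorem eval_recPoly {d n : ℕ} (s : Fin n → EuclideanSpace ℝ (Fin d))
    (P : Fin n → ℝ) (N β : ℝ) (i : Fin n) (x : EuclideanSpace ℝ (Fin d)) :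
    MvPolynomial.eval x.ofLp (recPoly s P N β i) =
      β * ((∑ j ∈ Finset.univ.erase i, P j * ∏ l ∈ Finset.univ.erase j, dist x (s l) ^ 2) +
        N * ∏ l, dist x (s l) ^ 2) - P i * ∏ l ∈ Finset.univ.erase i, dist x (s l) ^ 2 := by
  simp [recPoly, eval_sqDistPoly]

theorem recZone2_eq {d n : ℕ} (hn : 2 ≤ n) {s : Fin n → EuclideanSpace ℝ (Fin d)}
    (hs : Function.Injective s) {P : Fin n → ℝ} (hP : ∀ j, 0 < P j) {N β : ℝ} (hN : 0 ≤ N)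
    (hβ : 0 < β) (i : Fin n) :
    recZone2 s P N β i = {x | MvPolynomial.eval x.ofLp (recPoly s P N β i) ≤ 0} := by
  have : Nontrivial (Fin n) := Fin.nontrivial_iff_two_le.2 hn
  ext x
  rw [Set.mem_ofPred_eq, eval_recPoly]
  by_cases hx : x ∈ Set.range s
  · obtain ⟨k, rfl⟩ := hx
    have hmem : s k ∈ recZone2 s P N β i ↔ k = i := by
      simp [recZone2, hs.eq_iff]
    have hzero : ∀ t : Finset (Fin n), k ∈ t → ∏ l ∈ t, dist (s k) (s l) ^ 2 = 0 :=
      fun t ht => Finset.prod_eq_zero ht (by simp)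
    have hpos : 0 < ∏ l ∈ Finset.univ.erase k, dist (s k) (s l) ^ 2 :=
      Finset.prod_pos fun l hl => pow_pos (dist_pos.2 (hs.ne (Finset.ne_of_mem_erase hl).symm)) 2
    rw [hmem, hzero _ (Finset.mem_univ k), mul_zero, add_zero]
    by_cases hki : k = i
    · subst hki
      rw [Finset.sum_eq_zero fun j hj => by
        rw [hzero _ (Finset.mem_erase.2 ⟨(Finset.ne_of_mem_erase hj).symm, Finset.mem_univ k⟩),
          mul_zero]]
      have := mul_pos (hP k) hpos
      simp only [true_iff]
      linarith
    · rw [hzero (Finset.univ.erase i) (Finset.mem_erase.2 ⟨hki, Finset.mem_univ k⟩),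
        Finset.sum_eq_single_of_mem k (Finset.mem_erase.2 ⟨hki, Finset.mem_univ k⟩) fun j _ hj => by
          rw [hzero _ (Finset.mem_erase.2 ⟨hj.symm, Finset.mem_univ k⟩), mul_zero]]
      have := mul_pos hβ (mul_pos (hP k) hpos)
      simp only [hki, false_iff, not_le]
      linarith
  · have hne : ∀ l, x ≠ s l := fun l hl => hx ⟨l, hl.symm⟩
    have hD : ∀ l, 0 < dist x (s l) ^ 2 := fun l => pow_pos (dist_pos.2 (hne l)) 2
    have hmem : x ∈ recZone2 s P N β i ↔ β ≤ sinr2 s P N i x := by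
      simp [recZone2, hne i, fun l => (hne l).symm]
    have hQ : 0 < ∏ l, dist x (s l) ^ 2 := Finset.prod_pos fun l _ => hD l
    have herase : ∀ j, ∏ l ∈ Finset.univ.erase j, dist x (s l) ^ 2 =
        (∏ l, dist x (s l) ^ 2) / dist x (s j) ^ 2 := fun j => by
      rw [eq_div_iff (hD j).ne', Finset.prod_erase_mul _ _ (Finset.mem_univ j)]
    have hden : 0 < (∑ j ∈ Finset.univ.erase i, P j / dist x (s j) ^ 2) + N := by
      refine add_pos_of_pos_of_nonneg (Finset.sum_pos (fun j _ => div_pos (hP j) (hD j)) ?_) hN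
      obtain ⟨j, hj⟩ := exists_ne i
      exact ⟨j, Finset.mem_erase.2 ⟨hj, Finset.mem_univ j⟩⟩
    rw [hmem, sinr2, le_div_iff₀ hden]
    simp only [herase]
    have hsum : ∑ j ∈ Finset.univ.erase i, P j * ((∏ l, dist x (s l) ^ 2) / dist x (s j) ^ 2) =
        (∏ l, dist x (s l) ^ 2) * ∑ j ∈ Finset.univ.erase i, P j / dist x (s j) ^ 2 := by
      rw [Finset.mul_sum]
      exact Finset.sum_congr rfl fun j _ => by ring
    have hfactor : β * ((∏ l, dist x (s l) ^ 2) *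
          ∑ j ∈ Finset.univ.erase i, P j / dist x (s j) ^ 2 +
          N * ∏ l, dist x (s l) ^ 2) - P i * ((∏ l, dist x (s l) ^ 2) / dist x (s i) ^ 2) =
        (∏ l, dist x (s l) ^ 2) * (β * (∑ j ∈ Finset.univ.erase i, P j / dist x (s j) ^ 2 + N) -
          P i / dist x (s i) ^ 2) := by ring
    rw [hsum, hfactor, ← sub_nonpos]
    exact ⟨mul_nonpos_of_nonneg_of_nonpos hQ.le, fun h => le_of_not_gt fun h' =>
      h.not_gt (mul_pos hQ h')⟩

theorem total_number_of_cells_d_dimension (d : ℕ) (hd : 1 ≤ d) :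
    ∃ c : ℝ, 0 < c ∧
      ∀ n : ℕ, 2 ≤ n →
        ∀ s : Fin n → EuclideanSpace ℝ (Fin d), Function.Injective s →
          ∀ P : Fin n → ℝ, (∀ j, 0 < P j) →
            ∀ N β : ℝ, 0 ≤ N → 1 ≤ β →
              (∀ i, (componentsOf (recZone2 s P N β i)).Finite) ∧
              ((∑ i : Fin n, (componentsOf (recZone2 s P N β i)).ncard : ℕ) : ℝ)
                ≤ c * (n : ℝ) ^ (d + 1) := by
  refine ⟨4 ^ d, by positivity, fun n hn s hs P hP N β hN hβ => ?_⟩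
  have hcells : ∀ i, (componentsOf (recZone2 s P N β i)).Finite ∧
      (componentsOf (recZone2 s P N β i)).ncard ≤ (4 * n) ^ d := by
    intro i
    rw [recZone2_eq hn hs hP hN (zero_lt_one.trans_le hβ) i]
    refine finite_componentsOf_and_ncard_le fun ι _ y hyS hy => ?_
    have hdeg := totalDegree_recPoly_le s P N β i
    refine (card_le_pow_of_connectedComponentIn_ne (m := n + 1) (recPoly s P N β i)
      (by omega) y hyS hy).trans ?_
    rw [Fintype.card_fin]
    exact Nat.pow_le_pow_left (by omega) d
  refine ⟨fun i => (hcells i).1, ?_⟩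
  calc ((∑ i : Fin n, (componentsOf (recZone2 s P N β i)).ncard : ℕ) : ℝ)
      ≤ ((∑ _i : Fin n, (4 * n) ^ d : ℕ) : ℝ) := by
        exact_mod_cast Finset.sum_le_sum fun i _ => (hcells i).2
    _ = 4 ^ d * (n : ℝ) ^ (d + 1) := by
        rw [Finset.sum_const, Finset.card_univ, Fintype.card_fin, smul_eq_mul]
        push_cast
        ring
end
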